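/- Block norm of lifted word products. Let V be a finite type, Σ a finite alphabet, and E : Σ → V → V → Prop a deterministic labeled edge relation (for every c ∈ Σ and v ∈ V there is at most one w with E c v w). For c ∈ Σ let F c : Matrix V V ℝ have entries (F c) i j = 1 if E c j i and 0 otherwise, let A : Σ → Matrix (Fin n) (Fin n) ℝ, and define the lifted matrices P c := (F c) ⊗ (A c). For a word α : Fin N → Σ (N ≥ 1), let P_α := P(α(N-1)) * ⋯ * P(α 0) and A_α := A(α(N-1)) * ⋯ * A(α 0). Then |||P_α||| = ‖A_α‖ if α is feasible (some node admits a walk labeled α), and |||P_α||| = 0 otherwise, where ‖·‖ is the Frobenius norm and |||·||| the block norm. -/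

import Mathlib

open Kronecker
open scoped Classical

/-- Frobenius norm of a real `n × n` matrix. -/
noncomputable def frob {n : ℕ} (A : Matrix (Fin n) (Fin n) ℝ) : ℝ :=
  Real.sqrt (∑ i, ∑ j, (A i j) ^ 2)

/-- Transition matrix of label `c`: entry `(i, j)` is `1` if there is an edge
from `j` to `i` labeled `c`, and `0` otherwise. -/
noncomputable def transMat {V Γ : Type*} (E : Γ → V → V → Prop) (c : Γ) :
    Matrix V V ℝ :=
  fun i j => if E c j i then 1 else 0

/-- Ordered product `M (N-1) * ⋯ * M 1 * M 0` of a finite family of elements of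
a monoid. -/
def finWordProd {X : Type*} [Monoid X] {N : ℕ} (M : Fin N → X) : X :=
  ((List.ofFn M).reverse).prod

/-- The word `α` is feasible from node `v`. -/
def FeasibleFrom {V Γ : Type*} (E : Γ → V → V → Prop) {N : ℕ}
    (α : Fin N → Γ) (v : V) : Prop :=
  ∃ w : ℕ → V, w 0 = v ∧ ∀ (t : ℕ) (ht : t < N), E (α ⟨t, ht⟩) (w t) (w (t + 1))

/-- The word `α` is feasible: some node admits a walk labeled `α`. -/
def Feasible {V Γ : Type*} (E : Γ → V → V → Prop) {N : ℕ} (α : Fin N → Γ) : Prop :=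
  ∃ v : V, FeasibleFrom E α v

/-- The `(i, j)` block (an `n × n` matrix) of a block matrix indexed by
`V × Fin n`. -/
def blockOf {V : Type*} {n : ℕ} (M : Matrix (V × Fin n) (V × Fin n) ℝ)
    (i j : V) : Matrix (Fin n) (Fin n) ℝ :=
  fun a b => M (i, a) (j, b)

/-- Block norm `|||M||| = max_{j ∈ V} ∑_{i ∈ V} ‖M[i,j]‖` of a block matrix,
with `‖·‖` the Frobenius norm. -/
noncomputable def blockNorm {V : Type*} [Fintype V] {n : ℕ}
    (M : Matrix (V × Fin n) (V × Fin n) ℝ) : ℝ :=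
  ⨆ j : V, ∑ i : V, frob (blockOf M i j)

theorem finWordProd_zero {X : Type*} [Monoid X] (M : Fin 0 → X) : finWordProd M = 1 := by
  simp [finWordProd]

theorem finWordProd_succ {X : Type*} [Monoid X] {N : ℕ} (M : Fin (N + 1) → X) :
    finWordProd M = M (Fin.last N) * finWordProd (fun t => M t.castSucc) := by
  rw [finWordProd, finWordProd, List.ofFn_succ_last]
  simp

theorem finWordProd_kronecker {m n R : Type*} [Fintype m] [DecidableEq m] [Fintype n]
    [DecidableEq n] [CommSemiring R] {N : ℕ} (F : Fin N → Matrix m m R)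
    (A : Fin N → Matrix n n R) :
    finWordProd (fun t => F t ⊗ₖ A t) = finWordProd F ⊗ₖ finWordProd A := by
  induction N with
  | zero => simp [finWordProd_zero]
  | succ N ih => rw [finWordProd_succ, ih, ← Matrix.mul_kronecker_mul, ← finWordProd_succ,
      ← finWordProd_succ]

/-- There is a walk labeled `α` from `v` to `u`. -/
def WalkBetween {V Γ : Type*} (E : Γ → V → V → Prop) {N : ℕ} (α : Fin N → Γ) (v u : V) : Prop :=
  ∃ w : ℕ → V, w 0 = v ∧ w N = u ∧ ∀ (t : ℕ) (ht : t < N), E (α ⟨t, ht⟩) (w t) (w (t + 1))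

theorem feasibleFrom_iff_exists_walkBetween {V Γ : Type*} {E : Γ → V → V → Prop} {N : ℕ}
    {α : Fin N → Γ} {v : V} : FeasibleFrom E α v ↔ ∃ u, WalkBetween E α v u := by
  constructor
  · rintro ⟨w, h0, h⟩
    exact ⟨w N, w, h0, rfl, h⟩
  · rintro ⟨_, w, h0, -, h⟩
    exact ⟨w, h0, h⟩

theorem walkBetween_zero {V Γ : Type*} {E : Γ → V → V → Prop} {α : Fin 0 → Γ} {v u : V} :
    WalkBetween E α v u ↔ u = v := by
  constructor
  · rintro ⟨w, h0, hN, -⟩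
    exact hN.symm.trans h0
  · rintro rfl
    exact ⟨fun _ => u, rfl, rfl, fun t ht => absurd ht (Nat.not_lt_zero t)⟩

theorem walkBetween_succ {V Γ : Type*} {E : Γ → V → V → Prop} {N : ℕ} {α : Fin (N + 1) → Γ}
    {v u : V} : WalkBetween E α v u ↔
      ∃ k, WalkBetween E (fun t : Fin N => α t.castSucc) v k ∧ E (α (Fin.last N)) k u := by
  constructor
  · rintro ⟨w, h0, rfl, h⟩
    exact ⟨w N, ⟨w, h0, rfl, fun t ht => h t (by omega)⟩, h N (by omega)⟩
  · rintro ⟨k, ⟨w, h0, rfl, h⟩, hE⟩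
    refine ⟨fun t => if t ≤ N then w t else u, by simpa using h0, by simp, fun t ht => ?_⟩
    rcases Nat.lt_succ_iff_lt_or_eq.mp ht with htN | rfl
    · simpa [htN.le, Nat.succ_le_of_lt htN] using h t htN
    · simpa [Fin.last] using hE

theorem WalkBetween.unique {V Γ : Type*} {E : Γ → V → V → Prop}
    (hdet : ∀ (c : Γ) (v w w' : V), E c v w → E c v w' → w = w') {N : ℕ} {α : Fin N → Γ}
    {v u u' : V} (h : WalkBetween E α v u) (h' : WalkBetween E α v u') : u = u' := by
  induction N generalizing u u' with
  | zero => rw [walkBetween_zero.mp h, walkBetween_zero.mp h']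
  | succ N ih =>
    obtain ⟨k, hk, hE⟩ := walkBetween_succ.mp h
    obtain ⟨k', hk', hE'⟩ := walkBetween_succ.mp h'
    obtain rfl := ih hk hk'
    exact hdet _ _ _ _ hE hE'

theorem finWordProd_transMat_apply {V Γ : Type*} [Fintype V] [DecidableEq V]
    {E : Γ → V → V → Prop} (hdet : ∀ (c : Γ) (v w w' : V), E c v w → E c v w' → w = w')
    {N : ℕ} (α : Fin N → Γ) (i j : V) :
    finWordProd (fun t => transMat E (α t)) i j = if WalkBetween E α j i then 1 else 0 := by
  induction N generalizing i with
  | zero => simp [finWordProd_zero, walkBetween_zero, Matrix.one_apply]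
  | succ N ih =>
    rw [finWordProd_succ, Matrix.mul_apply]
    simp only [ih, walkBetween_succ]
    by_cases h : ∃ k, WalkBetween E (fun t : Fin N => α t.castSucc) j k
    · obtain ⟨k, hk⟩ := h
      have hiff : ∀ l, WalkBetween E (fun t : Fin N => α t.castSucc) j l ↔ l = k :=
        fun l => ⟨fun hl => hl.unique hdet hk, fun hl => hl ▸ hk⟩
      simp [hiff, transMat]
    · push Not at h
      simp [h]

theorem frob_nonneg {n : ℕ} (A : Matrix (Fin n) (Fin n) ℝ) : 0 ≤ frob A :=
  Real.sqrt_nonneg _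

theorem frob_zero {n : ℕ} : frob (0 : Matrix (Fin n) (Fin n) ℝ) = 0 := by
  simp [frob]

theorem blockOf_kronecker {V : Type*} {n : ℕ} (G : Matrix V V ℝ) (B : Matrix (Fin n) (Fin n) ℝ)
    (i j : V) : blockOf (G ⊗ₖ B) i j = G i j • B := by
  ext a b
  simp [blockOf]

theorem sum_frob_blockOf_lifted {V Γ : Type*} [Fintype V] [DecidableEq V]
    {E : Γ → V → V → Prop} (hdet : ∀ (c : Γ) (v w w' : V), E c v w → E c v w' → w = w')
    {n : ℕ} (A : Γ → Matrix (Fin n) (Fin n) ℝ) {N : ℕ} (α : Fin N → Γ) (j : V) :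
    ∑ i, frob (blockOf (finWordProd (fun t => transMat E (α t) ⊗ₖ A (α t))) i j) =
      if FeasibleFrom E α j then frob (finWordProd (fun t => A (α t))) else 0 := by
  simp only [finWordProd_kronecker, blockOf_kronecker, finWordProd_transMat_apply hdet, ite_smul,
    one_smul, zero_smul, apply_ite frob, frob_zero, feasibleFrom_iff_exists_walkBetween]
  split_ifs with h
  · obtain ⟨k, hk⟩ := h
    have hiff : ∀ l, WalkBetween E α j l ↔ l = k :=
      fun l => ⟨fun hl => hl.unique hdet hk, fun hl => hl ▸ hk⟩
    simp [hiff]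
  · push Not at h
    simp [h]

/-- **Block norm of lifted word products.** For a deterministic labeled edge
relation and lifted matrices `P c = (F c) ⊗ (A c)`, the block norm of the word
product `P_α` equals `‖A_α‖` if `α` is feasible, and `0` otherwise. -/
theorem blockNorm_lifted_wordProd {V Γ : Type*}
    [Fintype V] [DecidableEq V] [Fintype Γ]
    (E : Γ → V → V → Prop)
    (hdet : ∀ (c : Γ) (v w w' : V), E c v w → E c v w' → w = w')
    {n : ℕ} (A : Γ → Matrix (Fin n) (Fin n) ℝ)
    {N : ℕ} (hN : 1 ≤ N) (α : Fin N → Γ) :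
    (Feasible E α →
      blockNorm (finWordProd (fun t => transMat E (α t) ⊗ₖ A (α t))) =
        frob (finWordProd (fun t => A (α t)))) ∧
    (¬ Feasible E α →
      blockNorm (finWordProd (fun t => transMat E (α t) ⊗ₖ A (α t))) = 0) := by
  simp only [blockNorm, sum_frob_blockOf_lifted hdet]
  constructor
  · rintro ⟨v, hv⟩
    have : Nonempty V := ⟨v⟩
    refine le_antisymm (ciSup_le fun j => ?_) ?_
    · split_ifs
      exacts [le_rfl, frob_nonneg _]
    · exact le_ciSup_of_le (Set.finite_range _).bddAbove v (by rw [if_pos hv])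
  · intro h
    have h' : ∀ j, ¬ FeasibleFrom E α j := fun j hj => h ⟨j, hj⟩
    simp [h']
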